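/- Let Q be a finite group with |Q| ≥ 3 and let T ≤ Q be a subgroup such that the only normal subgroup of Q contained in T is the trivial subgroup. Let R = Q*_T be the HNN extension of Q with both associated subgroups equal to T and associated isomorphism the identity of T, let π̄ : R → Q be the natural projection which is the identity on Q and sends the stable letter to the identity, and let F = ker(π̄). If α is an automorphism of R satisfying α(F) = F and α(f) = f for all f ∈ F, then α is the identity automorphism of R. -/

import Mathlib

namespace FreeGroup

variable {α : Type*}

/-- A generator which is not the first letter of a non-trivial element does not commute with it. -/
theorem fst_head_eq_of_commute [DecidableEq α] {f : FreeGroup α} {x : α} (h : Commute (of x) f)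
    {p : α × Bool} {L : List (α × Bool)} (hf : f.toWord = p :: L) : p.1 = x := by
  by_contra hne
  have hred : IsReduced ((x, true) :: f.toWord) := by
    have hfred : IsReduced f.toWord := isReduced_toWord
    rw [hf] at hfred ⊢
    exact List.isChain_cons_cons.2 ⟨fun hx => absurd hx.symm hne, hfred⟩
  have hleft : (of x * f).toWord = (x, true) :: f.toWord := by
    rw [toWord_mul, toWord_of]
    exact hred.reduce_eq
  have hsub : List.Sublist ((x, true) :: f.toWord) (f.toWord ++ [(x, true)]) := by
    rw [← hleft, h.eq, ← toWord_of x]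
    exact toWord_mul_sublist f (of x)
  have heq := hsub.eq_of_length (by simp)
  rw [hf, List.cons_append, List.cons.injEq] at heq
  exact hne (by rw [← heq.1])

theorem eq_one_of_forall_commute_of [Nontrivial α] {f : FreeGroup α}
    (h : ∀ x, Commute (of x) f) : f = 1 := by
  classical
  rw [← toWord_eq_nil_iff]
  cases hf : f.toWord with
  | nil => rfl
  | cons p L =>
    obtain ⟨x, hx⟩ := exists_ne p.1
    exact absurd (fst_head_eq_of_commute (h x) hf).symm hx

/-- Conjugate generators of a free group are equal. -/
theorem eq_of_mul_of_eq_of_mul {f : FreeGroup α} {x y : α} (h : f * of y = of x * f) :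
    y = x := by
  classical
  have := congrArg (lift fun z => if z = x then Multiplicative.ofAdd (1 : ℤ) else 1) h
  rw [_root_.map_mul, _root_.map_mul, mul_comm, mul_right_cancel_iff, lift_apply_of, lift_apply_of,
    if_pos rfl] at this
  by_contra hne
  rw [if_neg hne] at this
  exact absurd this (by decide)

variable (α) in
/-- The action on a free group induced by permuting its generators. -/
def permAut : Equiv.Perm α →* MulAut (FreeGroup α) where
  toFun := freeGroupCongr
  map_one' := by ext1 x; exact map.id x
  map_mul' e₁ e₂ := by ext1 x; exact (map.comp e₂ e₁ x).symm

@[simp]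
theorem permAut_of (e : Equiv.Perm α) (x : α) : permAut α e (of x) = of (e x) :=
  map.of

end FreeGroup

namespace HNNExtension

variable {Q : Type*} [Group Q] (T : Subgroup Q)

/-- The action of `Q` on the free group on the cosets of `T`. -/
def cosetAut : Q →* MulAut (FreeGroup (Q ⧸ T)) :=
  (FreeGroup.permAut (Q ⧸ T)).comp (MulAction.toPermHom Q (Q ⧸ T))

@[simp]
theorem cosetAut_of (q : Q) (x : Q ⧸ T) :
    cosetAut T q (FreeGroup.of x) = FreeGroup.of (q • x) :=
  FreeGroup.permAut_of _ _

/-- The HNN extension `Q*_T` mapped to a semidirect product of a free group with `Q`. -/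
def toSemidirect :
    HNNExtension Q T T (MulEquiv.refl T) →* FreeGroup (Q ⧸ T) ⋊[cosetAut T] Q :=
  lift SemidirectProduct.inr (SemidirectProduct.inl (FreeGroup.of ((1 : Q) : Q ⧸ T))) (by
    intro a
    have ha : (a : Q) • ((1 : Q) : Q ⧸ T) = ((1 : Q) : Q ⧸ T) := by
      rw [MulAction.Quotient.smul_coe, smul_eq_mul, mul_one, eq_comm, QuotientGroup.eq]
      simp
    ext <;> simp [ha])

/-- The conjugate of the stable letter by a representative of a coset of `T`. -/
def conjT : Q ⧸ T → HNNExtension Q T T (MulEquiv.refl T) :=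
  Quotient.lift (fun g => of g * t * (of g)⁻¹) (by
    intro a b hab
    rw [← Quotient.eq_iff_equiv, Quotient.eq, QuotientGroup.leftRel_apply] at hab
    have h : t * of (a⁻¹ * b) = (of (a⁻¹ * b) * t : HNNExtension Q T T (MulEquiv.refl T)) :=
      t_mul_of (φ := MulEquiv.refl T) ⟨a⁻¹ * b, hab⟩
    have hb : of b = (of a * of (a⁻¹ * b) : HNNExtension Q T T (MulEquiv.refl T)) := by
      rw [← map_mul, mul_inv_cancel_left]
    change of a * t * (of a)⁻¹ = of b * t * (of b)⁻¹
    rw [hb, mul_assoc (of a) (of _) t, ← h]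
    group)

@[simp]
theorem conjT_mk (g : Q) : conjT T (g : Q ⧸ T) = of g * t * (of g)⁻¹ := rfl

/-- The semidirect product of the free group on the cosets with `Q` mapped to `Q*_T`. -/
def ofSemidirect :
    FreeGroup (Q ⧸ T) ⋊[cosetAut T] Q →* HNNExtension Q T T (MulEquiv.refl T) :=
  SemidirectProduct.lift (FreeGroup.lift (conjT T)) of (by
    intro q
    ext x
    induction x using QuotientGroup.induction_on with
    | H g => simp [mul_assoc])

theorem ofSemidirect_toSemidirect (x : HNNExtension Q T T (MulEquiv.refl T)) :
    ofSemidirect T (toSemidirect T x) = x := by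
  have h : (ofSemidirect T).comp (toSemidirect T) = MonoidHom.id _ := by
    apply hom_ext
    · ext g
      simp [ofSemidirect, toSemidirect]
    · simp [ofSemidirect, toSemidirect]
  exact DFunLike.congr_fun h x

theorem toSemidirect_conjT (x : Q ⧸ T) :
    toSemidirect T (conjT T x) = SemidirectProduct.inl (FreeGroup.of x) := by
  induction x using QuotientGroup.induction_on with
  | H g =>
    ext <;> simp [toSemidirect]

variable {T}

/-- If `T` is proper and core-free, only the identity commutes with all conjugates of the
stable letter by elements of `Q`. -/
theorem eq_one_of_forall_commute_conjT [Nontrivial (Q ⧸ T)] (hT : T.normalCore = ⊥)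
    {c : HNNExtension Q T T (MulEquiv.refl T)} (hc : ∀ x, Commute (conjT T x) c) : c = 1 := by
  have key (x : Q ⧸ T) : (toSemidirect T c).left * FreeGroup.of ((toSemidirect T c).right • x) =
      FreeGroup.of x * (toSemidirect T c).left := by
    have h := ((hc x).map (toSemidirect T)).eq
    rw [toSemidirect_conjT] at h
    simpa using (congrArg SemidirectProduct.left h).symm
  have hsmul (x : Q ⧸ T) : (toSemidirect T c).right • x = x :=
    FreeGroup.eq_of_mul_of_eq_of_mul (key x)
  have hright : (toSemidirect T c).right = 1 := by
    rw [← Subgroup.mem_bot, ← hT, Subgroup.normalCore_eq_ker, MonoidHom.mem_ker]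
    exact Equiv.ext hsmul
  have hleft : (toSemidirect T c).left = 1 :=
    FreeGroup.eq_one_of_forall_commute_of fun x => by
      have h := (key x).symm
      rwa [hsmul] at h
  rw [← ofSemidirect_toSemidirect T c,
    SemidirectProduct.ext (y := 1) hleft hright, map_one]

end HNNExtension


/-- Let `Q` be a finite group of order at least `3` and `T ≤ Q` a subgroup containing
no non-trivial normal subgroup of `Q`.  Let `R = Q*_T` be the HNN extension of `Q`
with both associated subgroups equal to `T` and associated isomorphism the identity,
let `π̄ : R → Q` be the natural projection restricting to the identity on `Q` and
sending the stable letter to `1`, and let `F = ker π̄`.  Any automorphism `α` of `R`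
with `α(F) = F` and `α|_F = id` is the identity automorphism of `R`. -/
theorem auto_of_hnn_fixing_kernel_is_id
    (Q : Type*) [Group Q] [Finite Q] (hQ : 3 ≤ Nat.card Q)
    (T : Subgroup Q) (hT : ∀ N : Subgroup Q, N.Normal → N ≤ T → N = ⊥)
    (α : MulAut (HNNExtension Q T T (MulEquiv.refl T)))
    (hker : Subgroup.map α.toMonoidHom
        (HNNExtension.lift (G := Q) (A := T) (B := T) (φ := MulEquiv.refl T)
          (MonoidHom.id Q) 1 (fun a => by simp)).ker =
      (HNNExtension.lift (G := Q) (A := T) (B := T) (φ := MulEquiv.refl T)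
          (MonoidHom.id Q) 1 (fun a => by simp)).ker)
    (hfix : ∀ f ∈ (HNNExtension.lift (G := Q) (A := T) (B := T) (φ := MulEquiv.refl T)
          (MonoidHom.id Q) 1 (fun a => by simp)).ker, α f = f) :
    ∀ x, α x = x := by
  intro x
  have hcore : T.normalCore = ⊥ := hT _ T.normalCore_normal T.normalCore_le
  have hne : T ≠ ⊤ := by
    rintro rfl
    have : Subsingleton Q :=
      Subgroup.subsingleton_iff.1 (subsingleton_of_bot_eq_top (hT ⊤ inferInstance le_rfl).symm)
    have := Nat.card_eq_one_iff_unique.2 ⟨this, ⟨1⟩⟩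
    omega
  have : Nontrivial (Q ⧸ T) := QuotientGroup.nontrivial_iff.2 hne
  have hone : x⁻¹ * α x = 1 := by
    refine HNNExtension.eq_one_of_forall_commute_conjT hcore fun y => ?_
    have hy : HNNExtension.conjT T y ∈ (HNNExtension.lift (G := Q) (A := T) (B := T)
        (φ := MulEquiv.refl T) (MonoidHom.id Q) 1 (fun a => by simp)).ker := by
      induction y using QuotientGroup.induction_on with
      | H g => simp [MonoidHom.mem_ker]
    have hconj := hfix _ (Subgroup.Normal.conj_mem inferInstance _ hy x)
    rw [map_mul, map_mul, hfix _ hy, map_inv, mul_inv_eq_iff_eq_mul] at hconj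
    change _ * _ = _ * _
    rw [mul_assoc x⁻¹, hconj]
    group
  exact (inv_mul_eq_one.1 hone).symm
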